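/- Let m be an odd positive integer and let δ be a real number with 0 < δ < 1/3 and H(3δ/2) < 1/2. Let c(X) ∈ J_m, let I_c = ⟨c(X)⟩ be the ideal of R_m generated by c(X), and let d_c = dim I_c. Then the number of pairs (f(X), g(X)) ∈ I_c × I_c with wt_H(f) + wt_H(g) ≤ 3mδ is at most 2^{2 d_c H(3δ/2)}. -/

import Mathlib

open Polynomial

noncomputable section

/-- The polynomial `X^m - 1` over `Z/2`. -/
def fm (m : ℕ) : Polynomial (ZMod 2) := X ^ m - 1

/-- The polynomial `X^m - 1` over `Z/4`. -/
def fm4 (m : ℕ) : Polynomial (ZMod 4) := X ^ m - 1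

/-- `R_m = (Z/2)[X]/⟨X^m - 1⟩`. -/
abbrev R2 (m : ℕ) : Type := Polynomial (ZMod 2) ⧸ Ideal.span {fm m}

/-- `R'_m = (Z/4)[X]/⟨X^m - 1⟩`. -/
abbrev R4 (m : ℕ) : Type := Polynomial (ZMod 4) ⧸ Ideal.span {fm4 m}

def mk2 (m : ℕ) : Polynomial (ZMod 2) →+* R2 m := Ideal.Quotient.mk _

def mk4 (m : ℕ) : Polynomial (ZMod 4) →+* R4 m := Ideal.Quotient.mk _

/-- The canonical representative (of degree `< m`) of an element of `R2 m`. -/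
def rep2 (m : ℕ) (r : R2 m) : Polynomial (ZMod 2) :=
  (Function.surjInv (Ideal.Quotient.mk_surjective (I := Ideal.span {fm m})) r) %ₘ fm m

/-- The canonical representative (of degree `< m`) of an element of `R4 m`. -/
def rep4 (m : ℕ) (r : R4 m) : Polynomial (ZMod 4) :=
  (Function.surjInv (Ideal.Quotient.mk_surjective (I := Ideal.span {fm4 m})) r) %ₘ fm4 m

/-- Coefficientwise doubling map `(Z/2)[X] → (Z/4)[X]`, `a ↦ 2a` on each coefficient. -/
def polyDbl (p : Polynomial (ZMod 2)) : Polynomial (ZMod 4) :=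
  ∑ i ∈ p.support, Polynomial.C (2 * ((p.coeff i).val : ZMod 4)) * X ^ i

/-- The additive embedding `R_m → R'_m`, `f ↦ 2f`. -/
def iota (m : ℕ) (r : R2 m) : R4 m := mk4 m (polyDbl (rep2 m r))

/-- Hamming weight of an element of `R_m` (of its coefficient vector). -/
def wt2 (m : ℕ) (r : R2 m) : ℕ := (rep2 m r).support.card

/-- Lee weight of an element of `Z/4`. -/
def lee (x : ZMod 4) : ℕ := min x.val (4 - x.val)

/-- Lee weight of an element of `R'_m` (of its coefficient vector). -/
def wtLee (m : ℕ) (r : R4 m) : ℕ := ∑ i ∈ (rep4 m r).support, lee ((rep4 m r).coeff i)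

/-- The augmentation ideal `J_m = ⟨X - 1⟩` of `R_m`. -/
def Jm (m : ℕ) : Ideal (R2 m) := Ideal.span {mk2 m (X - 1)}

/-- The `Z2Z4`-additive cyclic code `C_{a,b} = {(f·a, 2(f·b)) : f ∈ R_m}`. -/
def Cab (m : ℕ) (a b : R2 m) : Set (R2 m × R4 m) :=
  {w | ∃ f : R2 m, w = (f * a, iota m (f * b))}

/-- Dimension of `C_{a,b}` as a vector space over `Z/2`, i.e. `log₂ |C_{a,b}|`. -/
def dimCab (m : ℕ) (a b : R2 m) : ℕ := Nat.log 2 (Nat.card (Cab m a b))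

/-- `(X^m - 1)/(X - 1) = X^{m-1} + ⋯ + X + 1` over `Z/2`. -/
def geomPoly (m : ℕ) : Polynomial (ZMod 2) := ∑ i ∈ Finset.range m, X ^ i

/-- `ℓ_m`: minimal degree of the irreducible factors of `(X^m-1)/(X-1)` in `(Z/2)[X]`. -/
def ell (m : ℕ) : ℕ :=
  sInf {d | ∃ p : Polynomial (ZMod 2), Irreducible p ∧ p ∣ geomPoly m ∧ p.natDegree = d}

/-- The binary entropy function `H(x) = -x·log₂x - (1-x)·log₂(1-x)`. -/
def Hent (x : ℝ) : ℝ := -(x * Real.logb 2 x) - (1 - x) * Real.logb 2 (1 - x)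

theorem fm_monic (m : ℕ) (hm : 0 < m) : (fm m).Monic := by
  have := monic_X_pow_sub_C (1 : ZMod 2) hm.ne'
  simpa [fm] using this

theorem fm_degree (m : ℕ) (hm : 0 < m) : (fm m).degree = m := by
  have := degree_X_pow_sub_C hm (1 : ZMod 2)
  simpa [fm] using this

theorem mk2_surj (m : ℕ) : Function.Surjective (mk2 m) := Ideal.Quotient.mk_surjective

theorem mk2_fm (m : ℕ) : mk2 m (fm m) = 0 :=
  Ideal.Quotient.eq_zero_iff_mem.2 (Ideal.mem_span_singleton_self _)

theorem mk2_rep (m : ℕ) (r : R2 m) : mk2 m (rep2 m r) = r := by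
  have h := Function.surjInv_eq (Ideal.Quotient.mk_surjective (I := Ideal.span {fm m})) r
  unfold rep2
  rw [modByMonic_eq_sub_mul_div, map_sub, map_mul, mk2_fm, zero_mul, sub_zero]
  exact h

theorem rep2_degree (m : ℕ) (hm : 0 < m) (r : R2 m) : (rep2 m r).degree < m := by
  rw [← fm_degree m hm]
  exact degree_modByMonic_lt _ (fm_monic m hm)

theorem mk2_inj (m : ℕ) (hm : 0 < m) (p q : Polynomial (ZMod 2)) (hp : p.degree < m)
    (hq : q.degree < m) (h : mk2 m p = mk2 m q) : p = q := by
  have h1 : fm m ∣ p - q := Ideal.mem_span_singleton.1 (Ideal.Quotient.eq.1 h)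
  by_contra hne
  have h2 : p - q ≠ 0 := sub_ne_zero.2 hne
  have h3 := degree_le_of_dvd h1 h2
  rw [fm_degree m hm] at h3
  have h4 := degree_sub_le p q
  exact absurd (lt_of_le_of_lt (h3.trans h4) (max_lt hp hq)) (lt_irrefl _)

theorem rep2_unique (m : ℕ) (hm : 0 < m) (r : R2 m) (p : Polynomial (ZMod 2))
    (hp : p.degree < m) (h : mk2 m p = r) : rep2 m r = p :=
  mk2_inj m hm _ _ (rep2_degree m hm r) hp ((mk2_rep m r).trans h.symm)

/-- coordinates indexed cyclically -/
def vec (m : ℕ) (r : R2 m) (a : ZMod m) : ZMod 2 := (rep2 m r).coeff a.val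

theorem vec_inj (m : ℕ) (hm : 0 < m) : Function.Injective (vec m) := by
  intro r s h
  haveI : NeZero m := ⟨hm.ne'⟩
  rw [← mk2_rep m r, ← mk2_rep m s]
  congr 1
  ext i
  by_cases hi : i < m
  · have := congrFun h (i : ZMod m)
    simpa [vec, ZMod.val_natCast_of_lt hi] using this
  · have h1 : ((m : ℕ) : WithBot ℕ) ≤ (i : ℕ) := by exact_mod_cast not_lt.1 hi
    rw [coeff_eq_zero_of_degree_lt ((rep2_degree m hm r).trans_le h1),
      coeff_eq_zero_of_degree_lt ((rep2_degree m hm s).trans_le h1)]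

theorem r2_finite (m : ℕ) (hm : 0 < m) : Finite (R2 m) := by
  haveI : NeZero m := ⟨hm.ne'⟩
  exact Finite.of_injective _ (vec_inj m hm)

theorem r2_card (m : ℕ) (hm : 0 < m) : Nat.card (R2 m) ≤ 2 ^ m := by
  haveI : NeZero m := ⟨hm.ne'⟩
  have := Nat.card_le_card_of_injective _ (vec_inj m hm)
  simpa [Nat.card_eq_fintype_card] using this

theorem wt2_eq (m : ℕ) [NeZero m] (r : R2 m) :
    wt2 m r = (Finset.univ.filter (fun a : ZMod m => vec m r a ≠ 0)).card := by
  have hm : 0 < m := Nat.pos_of_ne_zero (NeZero.ne m)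
  unfold wt2
  symm
  refine Finset.card_bij (fun a _ => a.val) ?_ ?_ ?_
  · intro a ha
    exact mem_support_iff.2 (Finset.mem_filter.1 ha).2
  · intro a _ b _ h
    exact ZMod.val_injective m h
  · intro i hi
    have hi0 := mem_support_iff.1 hi
    have hlt : i < m := by
      by_contra hge
      apply hi0
      apply coeff_eq_zero_of_degree_lt
      exact (rep2_degree m hm r).trans_le (by exact_mod_cast not_lt.1 hge)
    refine ⟨(i : ZMod m), ?_, ZMod.val_natCast_of_lt hlt⟩
    refine Finset.mem_filter.2 ⟨Finset.mem_univ _, ?_⟩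
    simpa [vec, ZMod.val_natCast_of_lt hlt] using hi0

theorem vec_shift (m : ℕ) [NeZero m] (r : R2 m) (a : ZMod m) :
    vec m (mk2 m X * r) (a + 1) = vec m r a := by
  have hm : 0 < m := Nat.pos_of_ne_zero (NeZero.ne m)
  set p := rep2 m r with hp
  have hpd : p.degree < m := rep2_degree m hm r
  have hcoef : ∀ i, m ≤ i → p.coeff i = 0 := fun i hi =>
    coeff_eq_zero_of_degree_lt (hpd.trans_le (by exact_mod_cast hi))
  have key : rep2 m (mk2 m X * r) = X * p - C (p.coeff (m - 1)) * fm m := by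
    apply rep2_unique m hm
    · rw [degree_lt_iff_coeff_zero]
      intro i hi
      obtain ⟨k, rfl⟩ : ∃ k, i = k + 1 := ⟨i - 1, by omega⟩
      simp only [coeff_sub, coeff_X_mul, coeff_C_mul, fm, coeff_X_pow, coeff_one]
      by_cases hk : k + 1 = m
      · have : m - 1 = k := by omega
        simp [hk, this, hm.ne']
      · simp [hk, hcoef k (by omega)]
    · rw [map_sub, map_mul, map_mul, mk2_fm, mul_zero, sub_zero, mk2_rep]
  unfold vec
  rw [key, ← hp]
  have ha := ZMod.val_lt a
  have hv : (a + 1).val = (a.val + 1) % m := by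
    rw [ZMod.val_add, ZMod.val_one_eq_one_mod, Nat.add_mod_mod]
  rw [hv]
  by_cases h : a.val + 1 = m
  · have : m - 1 = a.val := by omega
    rw [h, Nat.mod_self]
    simp [fm, hm.ne, this]
  · rw [Nat.mod_eq_of_lt (by omega)]
    simp [fm, coeff_X_pow, coeff_one, h]

theorem vec_shift_pow (m : ℕ) [NeZero m] (r : R2 m) (a : ZMod m) (j : ℕ) :
    vec m (mk2 m X ^ j * r) (a + j) = vec m r a := by
  induction j with
  | zero => simp
  | succ j ih =>
    rw [pow_succ', mul_assoc, Nat.cast_succ, ← add_assoc, vec_shift, ih]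

theorem low_degree_zero (m : ℕ) (hm : 0 < m) (I : Ideal (R2 m)) (d : ℕ)
    (hd : Module.finrank (ZMod 2) I = d) (f : R2 m) (hf : f ∈ I)
    (hdeg : (rep2 m f).degree < (m - d : ℕ)) : f = 0 := by
  haveI := r2_finite m hm
  by_contra hne
  set p := rep2 m f with hp
  have hp0 : p ≠ 0 := by
    intro h
    apply hne
    rw [← mk2_rep m f, ← hp, h, map_zero]
  have hmem : ∀ q : Polynomial (ZMod 2), mk2 m (q * p) ∈ I := by
    intro q
    rw [map_mul, mk2_rep]
    exact I.mul_mem_left _ hf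
  let L : degreeLT (ZMod 2) (d + 1) →ₗ[ZMod 2] I :=
    { toFun := fun q => ⟨mk2 m (q.1 * p), hmem q.1⟩
      map_add' := by
        intro x y
        apply Subtype.ext
        simp [add_mul]
      map_smul' := by
        intro a x
        apply Subtype.ext
        simp only [Submodule.coe_smul, smul_mul_assoc]
        rfl }
  have hL : Function.Injective L := by
    intro x y h
    have h1 : mk2 m (x.1 * p) = mk2 m (y.1 * p) := congrArg Subtype.val h
    have hb : ∀ z : degreeLT (ZMod 2) (d + 1), (z.1 * p).degree < m := by
      intro z
      by_cases hz : z.1 = 0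
      · rw [hz, zero_mul, degree_zero]; exact WithBot.bot_lt_coe _
      have hz1 := mem_degreeLT.1 z.2
      rw [degree_eq_natDegree (mul_ne_zero hz hp0), natDegree_mul hz hp0]
      rw [degree_eq_natDegree hz] at hz1
      rw [degree_eq_natDegree hp0] at hdeg
      have h1 : z.1.natDegree < d + 1 := by exact_mod_cast hz1
      have h2 : p.natDegree < m - d := by exact_mod_cast hdeg
      have : z.1.natDegree + p.natDegree < m := by omega
      exact_mod_cast this
    exact Subtype.ext (mul_right_cancel₀ hp0 (mk2_inj m hm _ _ (hb x) (hb y) h1))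
  haveI : Module.Finite (ZMod 2) I := Module.Finite.of_finite
  have h1 := LinearMap.finrank_le_finrank_of_injective hL
  rw [hd, (degreeLTEquiv (ZMod 2) (d + 1)).finrank_eq] at h1
  simp at h1

/-- The last `d` coordinates. -/
def win (m : ℕ) [NeZero m] (d : ℕ) : Finset (ZMod m) :=
  Finset.univ.filter (fun a => m - d ≤ a.val)

theorem win_card (m : ℕ) [NeZero m] (d : ℕ) (hd : d ≤ m) : (win m d).card = d := by
  have : (win m d).card = (Finset.Ico (m - d) m).card := by
    refine Finset.card_bij (fun a _ => a.val) ?_ ?_ ?_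
    · intro a ha
      have := ZMod.val_lt a
      simp [win] at ha
      simp; omega
    · intro a _ b _ h
      exact ZMod.val_injective m h
    · intro i hi
      simp at hi
      refine ⟨(i : ZMod m), ?_, ZMod.val_natCast_of_lt hi.2⟩
      simp [win, ZMod.val_natCast_of_lt hi.2]; omega
  rw [this, Nat.card_Ico]; omega

theorem rep2_sub (m : ℕ) (hm : 0 < m) (f g : R2 m) :
    rep2 m (f - g) = rep2 m f - rep2 m g := by
  apply rep2_unique m hm
  · exact (degree_sub_le _ _).trans_lt (max_lt (rep2_degree m hm f) (rep2_degree m hm g))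
  · rw [map_sub, mk2_rep, mk2_rep]

theorem win_inj (m : ℕ) [NeZero m] (I : Ideal (R2 m)) (d : ℕ)
    (hd : Module.finrank (ZMod 2) I = d) (j : ZMod m) (f g : R2 m) (hf : f ∈ I) (hg : g ∈ I)
    (h : ∀ a ∈ win m d, vec m f (a - j) = vec m g (a - j)) : f = g := by
  have hm : 0 < m := Nat.pos_of_ne_zero (NeZero.ne m)
  have hs : ∀ r a, vec m (mk2 m X ^ j.val * r) a = vec m r (a - j) := by
    intro r a
    have := vec_shift_pow m r (a - j) j.val
    simpa using this
  have h0 : mk2 m X ^ j.val * f - mk2 m X ^ j.val * g = 0 := by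
    apply low_degree_zero m hm I d hd
    · exact I.sub_mem (I.mul_mem_left _ hf) (I.mul_mem_left _ hg)
    · rw [degree_lt_iff_coeff_zero]
      intro i hi
      by_cases him : i < m
      · have h1 := h (i : ZMod m) (by simp [win, ZMod.val_natCast_of_lt him]; omega)
        rw [← hs, ← hs] at h1
        rw [rep2_sub m hm, coeff_sub, sub_eq_zero]
        simpa [vec, ZMod.val_natCast_of_lt him] using h1
      · exact coeff_eq_zero_of_degree_lt
          ((rep2_degree m hm _).trans_le (by exact_mod_cast not_lt.1 him))
  apply vec_inj m hm
  funext a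
  have := congrFun (congrArg (vec m) (sub_eq_zero.1 h0)) (a + j)
  rw [hs, hs] at this
  simpa using this

/-- Bernoulli weight. -/
def ph (l : ℝ) (x : ZMod 2) : ℝ := if x ≠ 0 then l else 1 - l

theorem ph_pos (l : ℝ) (h0 : 0 < l) (h1 : l < 1) (x : ZMod 2) : 0 < ph l x := by
  unfold ph; split_ifs <;> linarith

theorem sum_win_le (m : ℕ) [NeZero m] (I : Ideal (R2 m)) (d : ℕ)
    (hd : Module.finrank (ZMod 2) I = d) (j : ZMod m) (l : ℝ) (h0 : 0 < l) (h1 : l < 1)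
    (S : Finset (R2 m)) (hS : ∀ f ∈ S, f ∈ I) :
    ∑ f ∈ S, ∏ a ∈ win m d, ph l (vec m f (a - j)) ≤ 1 := by
  classical
  let F : R2 m → (win m d → ZMod 2) := fun f a => vec m f (a.1 - j)
  have hF : Set.InjOn F S := by
    intro f hf g hg h
    refine win_inj m I d hd j f g (hS f hf) (hS g hg) ?_
    intro a ha
    exact congrFun h ⟨a, ha⟩
  have e1 : ∀ f, ∏ a ∈ win m d, ph l (vec m f (a - j)) = ∏ a : win m d, ph l (F f a) := by
    intro f
    exact (Finset.prod_coe_sort (win m d) (fun a => ph l (vec m f (a - j)))).symm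
  simp_rw [e1]
  rw [← Finset.sum_image (f := fun u : win m d → ZMod 2 => ∏ a, ph l (u a)) hF]
  calc _ ≤ ∑ u : win m d → ZMod 2, ∏ a, ph l (u a) :=
        Finset.sum_le_sum_of_subset_of_nonneg (Finset.subset_univ _)
          (fun u _ _ => Finset.prod_nonneg (fun a _ => (ph_pos l h0 h1 _).le))
    _ = ∏ a : win m d, ∑ x : ZMod 2, ph l x := (Fintype.prod_sum (fun _ x => ph l x)).symm
    _ = 1 := by
        have : ∑ x : ZMod 2, ph l x = 1 := by
          rw [show (Finset.univ : Finset (ZMod 2)) = {0, 1} from rfl]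
          simp [ph]
        simp [this]

theorem sum_log_ph (m : ℕ) [NeZero m] (l : ℝ) (f : R2 m) :
    ∑ b : ZMod m, Real.log (ph l (vec m f b))
      = m * Real.log (1 - l) - wt2 m f * (Real.log (1 - l) - Real.log l) := by
  have : ∀ b : ZMod m, Real.log (ph l (vec m f b)) = Real.log (1 - l) -
      (if vec m f b ≠ 0 then (Real.log (1 - l) - Real.log l) else 0) := by
    intro b
    unfold ph
    split_ifs <;> ring
  simp_rw [this]
  rw [Finset.sum_sub_distrib, ← Finset.sum_filter, wt2_eq, Finset.sum_const, Finset.sum_const]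
  rw [nsmul_eq_mul, nsmul_eq_mul, Finset.card_univ, ZMod.card]

theorem sum_prod_ge (m : ℕ) [NeZero m] (d : ℕ) (hd : d ≤ m) (l : ℝ) (h0 : 0 < l)
    (h1 : l < 1 / 2) (f g : R2 m) (hw : ((wt2 m f + wt2 m g : ℕ) : ℝ) ≤ 2 * m * l) :
    m * Real.exp (2 * d * (l * Real.log l + (1 - l) * Real.log (1 - l))) ≤
      ∑ j : ZMod m, (∏ a ∈ win m d, ph l (vec m f (a - j))) *
        (∏ a ∈ win m d, ph l (vec m g (a - j))) := by
  set s := 2 * d * (l * Real.log l + (1 - l) * Real.log (1 - l)) with hs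
  let t : ZMod m → ℝ := fun j => (∑ a ∈ win m d, Real.log (ph l (vec m f (a - j)))) +
    ∑ a ∈ win m d, Real.log (ph l (vec m g (a - j)))
  have hp := ph_pos l h0 (by linarith)
  have ht : ∀ j : ZMod m, (∏ a ∈ win m d, ph l (vec m f (a - j))) *
        (∏ a ∈ win m d, ph l (vec m g (a - j))) = Real.exp (t j) := by
    intro j
    simp only [t, Real.exp_add, Real.exp_sum, Real.exp_log (hp _)]
  simp_rw [ht]
  have hsum1 : ∀ f : R2 m, ∑ j : ZMod m, ∑ a ∈ win m d, Real.log (ph l (vec m f (a - j)))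
      = d * (m * Real.log (1 - l) - wt2 m f * (Real.log (1 - l) - Real.log l)) := by
    intro f
    rw [Finset.sum_comm]
    have : ∀ a : ZMod m, ∑ j : ZMod m, Real.log (ph l (vec m f (a - j)))
        = m * Real.log (1 - l) - wt2 m f * (Real.log (1 - l) - Real.log l) := by
      intro a
      rw [← sum_log_ph]
      exact (Equiv.subLeft a).sum_comp (fun b => Real.log (ph l (vec m f b)))
    simp_rw [this]
    rw [Finset.sum_const, win_card m d hd, nsmul_eq_mul]
  have hsum : m * s ≤ ∑ j, t j := by
    simp only [t]
    rw [Finset.sum_add_distrib, hsum1, hsum1, hs]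
    have hlog : 0 ≤ Real.log (1 - l) - Real.log l :=
      sub_nonneg.2 (Real.log_le_log h0 (by linarith))
    push_cast at hw
    have h2 := mul_le_mul_of_nonneg_left (mul_le_mul_of_nonneg_right hw hlog)
      (Nat.cast_nonneg (α := ℝ) d)
    nlinarith [h2]
  calc m * Real.exp s ≤ Real.exp s * (m + (∑ j, t j) - m * s) := by
        nlinarith [Real.exp_pos s]
    _ = ∑ j : ZMod m, Real.exp s * (1 + t j - s) := by
        have h6 : ∑ j : ZMod m, (1 + t j - s) = m + (∑ j, t j) - m * s := by
          rw [Finset.sum_sub_distrib (fun j => 1 + t j) (fun _ => s),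
            Finset.sum_add_distrib (f := fun _ => (1 : ℝ)) (g := t), Finset.sum_const,
            Finset.sum_const, nsmul_eq_mul, nsmul_eq_mul, Finset.card_univ, ZMod.card, mul_one]
        rw [← Finset.mul_sum, h6]
    _ ≤ ∑ j : ZMod m, Real.exp (t j) := by
        apply Finset.sum_le_sum
        intro j _
        have h3 := Real.add_one_le_exp (t j - s)
        have h4 : Real.exp (t j) = Real.exp s * Real.exp (t j - s) := by
          rw [← Real.exp_add]; congr 1; ring
        rw [h4]
        exact mul_le_mul_of_nonneg_left (by linarith) (Real.exp_pos s).le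

/-- For `c ∈ J_m` with `I_c = ⟨c⟩` of `Z/2`-dimension `d_c`, the number of
pairs `(f,g) ∈ I_c × I_c` with `wt_H(f) + wt_H(g) ≤ 3mδ` is at most `2^{2 d_c H(3δ/2)}`. -/
theorem statement7 (m : ℕ) (hm : Odd m) (hmpos : 0 < m)
    (δ : ℝ) (hδ0 : 0 < δ) (hδ1 : δ < 1/3) (hδ2 : Hent (3*δ/2) < 1/2)
    (c : R2 m) (hc : c ∈ Jm m) (dc : ℕ)
    (hdc : dc = Module.finrank (ZMod 2) (Ideal.span {c} : Ideal (R2 m))) :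
    (Nat.card {p : R2 m × R2 m // p.1 ∈ Ideal.span {c} ∧ p.2 ∈ Ideal.span {c} ∧
        ((wt2 m p.1 + wt2 m p.2 : ℕ) : ℝ) ≤ 3 * m * δ} : ℝ)
      ≤ (2 : ℝ) ^ (2 * (dc : ℝ) * Hent (3*δ/2)) := by
  classical
  haveI : NeZero m := ⟨hmpos.ne'⟩
  haveI := r2_finite m hmpos
  haveI := Fintype.ofFinite (R2 m)
  set I : Ideal (R2 m) := Ideal.span {c} with hI
  set l : ℝ := 3 * δ / 2 with hl
  have hl0 : 0 < l := by rw [hl]; linarith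
  have hl1 : l < 1 / 2 := by rw [hl]; linarith
  have hd : dc ≤ m := by
    haveI : Module.Finite (ZMod 2) I := Module.Finite.of_finite
    have h1 : Nat.card I = 2 ^ dc := by
      rw [hdc, Module.natCard_eq_pow_finrank (K := ZMod 2)]; simp
    have h2 : Nat.card I ≤ Nat.card (R2 m) := Nat.card_le_card_of_injective _ Subtype.val_injective
    have h3 := h2.trans (r2_card m hmpos)
    rw [h1] at h3
    exact (Nat.pow_le_pow_iff_right (by norm_num)).1 h3
  let SI : Finset (R2 m) := Finset.univ.filter (fun f => f ∈ I)
  let T : Finset (R2 m × R2 m) := Finset.univ.filter (fun p => p.1 ∈ I ∧ p.2 ∈ I ∧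
        ((wt2 m p.1 + wt2 m p.2 : ℕ) : ℝ) ≤ 3 * m * δ)
  have hcard : Nat.card {p : R2 m × R2 m // p.1 ∈ I ∧ p.2 ∈ I ∧
        ((wt2 m p.1 + wt2 m p.2 : ℕ) : ℝ) ≤ 3 * m * δ} = T.card := by
    rw [Nat.card_eq_fintype_card, Fintype.card_subtype]
  rw [hcard]
  set s := 2 * dc * (l * Real.log l + (1 - l) * Real.log (1 - l)) with hs
  have hrhs : (2 : ℝ) ^ (2 * (dc : ℝ) * Hent l) = Real.exp (-s) := by
    rw [Real.rpow_def_of_pos (by norm_num)]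
    congr 1
    have : Real.log 2 ≠ 0 := (Real.log_pos (by norm_num)).ne'
    unfold Hent Real.logb
    rw [hs]
    field_simp
    ring
  rw [hrhs]
  let Q : ZMod m → R2 m → ℝ := fun j f => ∏ a ∈ win m dc, ph l (vec m f (a - j))
  have hQ0 : ∀ j f, 0 ≤ Q j f := fun j f =>
    Finset.prod_nonneg (fun a _ => (ph_pos l hl0 (by linarith) _).le)
  have hQ : ∀ j, ∑ f ∈ SI, Q j f ≤ 1 := fun j =>
    sum_win_le m I dc hdc.symm j l hl0 (by linarith) SI (fun f hf => (Finset.mem_filter.1 hf).2)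
  have hub : ∀ j, ∑ p ∈ T, Q j p.1 * Q j p.2 ≤ 1 := by
    intro j
    calc ∑ p ∈ T, Q j p.1 * Q j p.2 ≤ ∑ p ∈ SI ×ˢ SI, Q j p.1 * Q j p.2 := by
          apply Finset.sum_le_sum_of_subset_of_nonneg
          · intro p hp
            have := (Finset.mem_filter.1 hp).2
            simp [SI, this.1, this.2.1]
          · intro p _ _
            exact mul_nonneg (hQ0 _ _) (hQ0 _ _)
      _ = (∑ f ∈ SI, Q j f) * (∑ f ∈ SI, Q j f) := by
          rw [Finset.sum_mul_sum, Finset.sum_product]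
      _ ≤ 1 := mul_le_one₀ (hQ j) (Finset.sum_nonneg (fun f _ => hQ0 j f)) (hQ j)
  have hlb : ∀ p ∈ T, m * Real.exp s ≤ ∑ j : ZMod m, Q j p.1 * Q j p.2 := by
    intro p hp
    apply sum_prod_ge m dc hd l hl0 hl1
    refine (Finset.mem_filter.1 hp).2.2.2.trans (le_of_eq ?_)
    rw [hl]; ring
  have htot : T.card * (m * Real.exp s) ≤ m := by
    calc T.card * (m * Real.exp s) = ∑ p ∈ T, m * Real.exp s := by simp
      _ ≤ ∑ p ∈ T, ∑ j : ZMod m, Q j p.1 * Q j p.2 := Finset.sum_le_sum hlb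
      _ = ∑ j : ZMod m, ∑ p ∈ T, Q j p.1 * Q j p.2 := Finset.sum_comm
      _ ≤ ∑ j : ZMod m, 1 := Finset.sum_le_sum (fun j _ => hub j)
      _ = m := by simp [ZMod.card]
  have hmR : (0 : ℝ) < m := by exact_mod_cast hmpos
  have h5 : (T.card : ℝ) * Real.exp s ≤ 1 := by
    by_contra hlt
    push Not at hlt
    nlinarith
  rw [Real.exp_neg, ← one_div, le_div_iff₀ (Real.exp_pos s)]
  exact h5

end
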